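/- Let n ≥ 4 be an integer and let 0 < r < r_n. Let v be a vertex of P_n and let p ∈ P_n be arbitrary. Suppose v' ∈ P_n satisfies |v − v'| = r and every point z of P_n strictly counterclockwise-between v and v' satisfies |v − z| < r; and suppose p' ∈ P_n satisfies |p − p'| = r and every point z of P_n strictly counterclockwise-between p and p' satisfies |p − z| < r. Then d_{P_n}(v, v') ≤ d_{P_n}(p, p'). -/

import Mathlib

noncomputable section

/-- The primitive `n`-th root of unity `ω = exp(2πi/n)`. -/
def nroot (n : ℕ) : ℂ := Complex.exp (2 * Real.pi * Complex.I / n)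

/-- The boundary of the regular `n`-gon inscribed in the unit circle, as a subset of `ℂ`:
the union of the closed segments from `ω^j` to `ω^(j+1)` for `j = 0, …, n-1`. -/
def polygon (n : ℕ) : Set ℂ :=
  ⋃ j ∈ Finset.range n, segment ℝ ((nroot n) ^ j) ((nroot n) ^ (j + 1))

/-- The critical scale `r_n`: `2 cos(π/n)` for even `n`,
and `1 + cos(2π/n)/cos(π/n)` for odd `n`. -/
def rpoly (n : ℕ) : ℝ :=
  if Even n then 2 * Real.cos (Real.pi / n)
  else 1 + Real.cos (2 * Real.pi / n) / Real.cos (Real.pi / n)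

/-- Arc-length parametrization of the polygon `P_n` by the parameter `t` (normalized so that
`t ∈ [0,1)` traverses the polygon once counterclockwise, with vertices at `t = j/n`). -/
def polyParam (n : ℕ) (t : ℝ) : ℂ :=
  ((1 - Int.fract (n * t) : ℝ) : ℂ) * (nroot n) ^ (⌊(n : ℝ) * t⌋) +
    ((Int.fract (n * t) : ℝ) : ℂ) * (nroot n) ^ (⌊(n : ℝ) * t⌋ + 1)

/-- The parameter value in `[0,1)` of a point `x ∈ P_n`. -/
def polyArg (n : ℕ) (x : ℂ) : ℝ :=
  sInf {t : ℝ | t ∈ Set.Ico (0 : ℝ) 1 ∧ polyParam n t = x}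

/-- The normalized counterclockwise arc distance from `x` to `y` along `P_n`: the length of the
counterclockwise path along `P_n` from `x` to `y` divided by the total perimeter of `P_n`. -/
def polyDist (n : ℕ) (x y : ℂ) : ℝ := Int.fract (polyArg n y - polyArg n x)

/-- `z` is strictly counterclockwise-between `x` and `y` on `P_n`. -/
def SCCWBtw (n : ℕ) (x z y : ℂ) : Prop :=
  0 < polyDist n x z ∧ polyDist n x z < polyDist n x y

/-- An inscribed equilateral `(2l+1)`-pointed star of side length `r` based at `p ∈ P_n`:
a tuple `(u 0, …, u (2l+1))` of points of `P_n` with `u 0 = u (2l+1) = p`, where consecutive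
points are at Euclidean distance `r`, every point of `P_n` strictly counterclockwise-between
`u i` and `u (i+1)` is at distance `< r` from `u i`, and the total winding number is `l`. -/
def IsStar (n l : ℕ) (r : ℝ) (p : ℂ) (u : ℕ → ℂ) : Prop :=
  u 0 = p ∧ u (2 * l + 1) = p ∧
  (∀ i ≤ 2 * l + 1, u i ∈ polygon n) ∧
  (∀ i ≤ 2 * l, dist (u i) (u (i + 1)) = r) ∧
  (∀ i ≤ 2 * l, ∀ z ∈ polygon n, SCCWBtw n (u i) z (u (i + 1)) → dist (u i) z < r) ∧
  (∑ i ∈ Finset.range (2 * l + 1), polyDist n (u i) (u (i + 1))) = (l : ℝ)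

/-- `x` is a vertex of `P_n`. -/
def IsVertex (n : ℕ) (x : ℂ) : Prop := ∃ j < n, x = (nroot n) ^ j

/-- `x` is the midpoint of an edge of `P_n`. -/
def IsMidpoint (n : ℕ) (x : ℂ) : Prop :=
  ∃ j < n, x = ((nroot n) ^ j + (nroot n) ^ (j + 1)) / 2

end

/-- The polygon parametrized over `ℝ` so that vertices sit at the integers. -/
noncomputable def edgeParam (n : ℕ) (u : ℝ) : ℂ :=
  ((1 - Int.fract u : ℝ) : ℂ) * (nroot n) ^ ⌊u⌋ + ((Int.fract u : ℝ) : ℂ) * (nroot n) ^ (⌊u⌋ + 1)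

theorem polyParam_eq_edgeParam (n : ℕ) (t : ℝ) : polyParam n t = edgeParam n (n * t) := rfl

theorem nroot_ne_zero (n : ℕ) : nroot n ≠ 0 := Complex.exp_ne_zero _

theorem nroot_zpow (n : ℕ) (k : ℤ) :
    nroot n ^ k = Complex.exp ((2 * Real.pi * k / n : ℝ) * Complex.I) := by
  rw [nroot, ← Complex.exp_int_mul]
  congr 1
  push_cast
  ring

theorem norm_nroot_zpow (n : ℕ) (k : ℤ) : ‖nroot n ^ k‖ = 1 := by
  rw [nroot_zpow, Complex.norm_exp_ofReal_mul_I]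

theorem conj_nroot_zpow (n : ℕ) (k : ℤ) :
    (starRingEnd ℂ) (nroot n ^ k) = nroot n ^ (-k) := by
  rw [nroot_zpow, nroot_zpow, ← Complex.exp_conj]
  congr 1
  rw [map_mul, Complex.conj_ofReal, Complex.conj_I]
  push_cast
  ring

theorem nroot_pow_self {n : ℕ} (hn : n ≠ 0) : nroot n ^ n = 1 :=
  (Complex.isPrimitiveRoot_exp n hn).pow_eq_one

theorem nroot_ne_one {n : ℕ} (hn : 1 < n) : nroot n ≠ 1 :=
  (Complex.isPrimitiveRoot_exp n (by lia)).ne_one hn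

theorem edgeParam_eq_of_mem (n : ℕ) (k : ℤ) {u : ℝ} (h₀ : (k : ℝ) ≤ u) (h₁ : u ≤ k + 1) :
    edgeParam n u = ((k + 1 - u : ℝ) : ℂ) * nroot n ^ k + ((u - k : ℝ) : ℂ) * nroot n ^ (k + 1) := by
  rcases h₁.lt_or_eq with h | h
  · have hk : ⌊u⌋ = k := Int.floor_eq_iff.2 ⟨h₀, h⟩
    have hf : Int.fract u = u - k := by rw [← hk]; rfl
    rw [edgeParam, hk, hf]
    push_cast
    ring
  · have h' : u = ((k + 1 : ℤ) : ℝ) := by push_cast; exact h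
    rw [edgeParam, h', Int.fract_intCast, Int.floor_intCast]
    push_cast
    ring

theorem edgeParam_intCast (n : ℕ) (k : ℤ) : edgeParam n k = nroot n ^ k := by
  simp [edgeParam]

theorem edgeParam_add_int (n : ℕ) (u : ℝ) (m : ℤ) :
    edgeParam n (u + m) = nroot n ^ m * edgeParam n u := by
  simp only [edgeParam, Int.fract_add_intCast, Int.floor_add_intCast]
  rw [show ⌊u⌋ + m + 1 = m + (⌊u⌋ + 1) by ring, add_comm ⌊u⌋ m,
    zpow_add₀ (nroot_ne_zero n) m, zpow_add₀ (nroot_ne_zero n) m]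
  ring

theorem edgeParam_neg (n : ℕ) (u : ℝ) :
    edgeParam n (-u) = (starRingEnd ℂ) (edgeParam n u) := by
  have h₀ := Int.floor_le u
  have h₁ := (Int.lt_floor_add_one u).le
  rw [edgeParam_eq_of_mem n ⌊u⌋ h₀ h₁, edgeParam_eq_of_mem n (-(⌊u⌋ + 1)) (u := -u)
    (by push_cast; linarith) (by push_cast; linarith)]
  simp only [map_add, map_mul, Complex.conj_ofReal, conj_nroot_zpow]
  rw [show -(⌊u⌋ + 1) + 1 = -⌊u⌋ by ring]
  push_cast
  ring

theorem edgeParam_add_nat_mul {n : ℕ} (hn : n ≠ 0) (u : ℝ) (m : ℤ) :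
    edgeParam n (u + n * m) = edgeParam n u := by
  have h := edgeParam_add_int n u (n * m)
  rw [zpow_mul, zpow_natCast, nroot_pow_self hn, one_zpow, one_mul] at h
  rw [← h]
  push_cast
  rfl

theorem norm_convex_combination_le {E : Type*} [SeminormedAddCommGroup E] [NormedSpace ℝ E]
    {x y : E} {a b c : ℝ} (ha : 0 ≤ a) (hb : 0 ≤ b) (hab : a + b = 1) (hx : ‖x‖ ≤ c)
    (hy : ‖y‖ ≤ c) : ‖a • x + b • y‖ ≤ c := by
  have h := convex_closedBall (0 : E) c (x := x) (by simpa using hx) (y := y) (by simpa using hy)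
    ha hb hab
  simpa using h

/-- Among all chords of the polygon spanning a fixed arc length, those starting at a vertex are
longest. -/
theorem norm_edgeParam_add_sub_le (n : ℕ) (u t : ℝ) :
    ‖edgeParam n (u + t) - edgeParam n u‖ ≤ ‖edgeParam n t - edgeParam n 0‖ := by
  wlog hu : 0 ≤ u ∧ u < 1 generalizing u
  · have h := this (Int.fract u) ⟨Int.fract_nonneg u, Int.fract_lt_one u⟩
    have e₁ : u + t = (Int.fract u + t) + ⌊u⌋ := by
      linarith [Int.fract_add_floor u]
    have e₂ : edgeParam n u = nroot n ^ ⌊u⌋ * edgeParam n (Int.fract u) := by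
      rw [← edgeParam_add_int, Int.fract_add_floor]
    rwa [e₁, e₂, edgeParam_add_int, ← mul_sub, norm_mul, norm_nroot_zpow, one_mul]
  obtain ⟨hu₀, hu₁⟩ := hu
  set k := ⌊t⌋ with hk
  set δ := Int.fract t with hδ
  have ht : t = k + δ := (Int.floor_add_fract t).symm
  have hδ₀ : 0 ≤ δ := Int.fract_nonneg t
  have hδ₁ : δ < 1 := Int.fract_lt_one t
  have hzero : edgeParam n 0 = 1 := by simpa using edgeParam_intCast n 0
  have hmid : ‖edgeParam n ((k + 1 : ℤ) : ℝ) - edgeParam n (1 - δ)‖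
      = ‖edgeParam n t - edgeParam n 0‖ := by
    have e : (1 - δ : ℝ) = -t + ((k + 1 : ℤ) : ℝ) := by rw [ht]; push_cast; ring
    rw [e, edgeParam_add_int, edgeParam_intCast, edgeParam_neg, hzero, ← mul_one_sub, norm_mul,
      norm_nroot_zpow, one_mul, ← norm_neg, neg_sub, ← Complex.norm_conj]
    simp
  have hone : ‖edgeParam n (t + (1 : ℤ)) - edgeParam n (1 : ℤ)‖
      = ‖edgeParam n t - edgeParam n 0‖ := by
    rw [edgeParam_add_int, edgeParam_intCast, hzero, ← mul_sub_one, norm_mul, norm_nroot_zpow,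
      one_mul]
  have hstart : edgeParam n u = ((1 - u : ℝ) : ℂ) * nroot n ^ (0 : ℤ)
      + (u : ℂ) * nroot n ^ (1 : ℤ) := by
    rw [edgeParam_eq_of_mem n 0 (by simpa using hu₀) (by simpa using hu₁.le)]
    simp
  have hcut : edgeParam n (1 - δ) = ((δ : ℝ) : ℂ) * nroot n ^ (0 : ℤ)
      + ((1 - δ : ℝ) : ℂ) * nroot n ^ (1 : ℤ) := by
    rw [edgeParam_eq_of_mem n 0 (by simpa using hδ₁.le) (by simpa using hδ₀)]
    simp
  rcases le_total u (1 - δ) with h | h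
  · have hpos : 0 < 1 - δ := by linarith
    have key : edgeParam n (u + t) - edgeParam n u
        = (1 - u / (1 - δ)) • (edgeParam n t - edgeParam n 0)
          + (u / (1 - δ)) • (edgeParam n ((k + 1 : ℤ) : ℝ) - edgeParam n (1 - δ)) := by
      rw [hstart, hcut, hzero, edgeParam_intCast,
        edgeParam_eq_of_mem n k (u := t) (by linarith) (by linarith),
        edgeParam_eq_of_mem n k (u := u + t) (by linarith) (by linarith), ht]
      have : ((1 - δ : ℝ) : ℂ) ≠ 0 := by exact_mod_cast hpos.ne'
      simp only [Complex.real_smul]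
      push_cast at this ⊢
      rw [zpow_zero]
      field_simp
      ring
    rw [key]
    refine norm_convex_combination_le ?_ (by positivity) (by ring) le_rfl hmid.le
    rw [sub_nonneg, div_le_one hpos]
    exact h
  · have hpos : 0 < δ := by linarith
    have key : edgeParam n (u + t) - edgeParam n u
        = ((1 - u) / δ) • (edgeParam n ((k + 1 : ℤ) : ℝ) - edgeParam n (1 - δ))
          + (1 - (1 - u) / δ) • (edgeParam n (t + (1 : ℤ)) - edgeParam n (1 : ℤ)) := by
      rw [hstart, hcut, edgeParam_intCast, edgeParam_intCast,
        edgeParam_eq_of_mem n (k + 1) (u := t + (1 : ℤ)) (by push_cast; linarith)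
          (by push_cast; linarith),
        edgeParam_eq_of_mem n (k + 1) (u := u + t) (by push_cast; linarith)
          (by push_cast; linarith), ht]
      have : (δ : ℂ) ≠ 0 := by exact_mod_cast hpos.ne'
      simp only [Complex.real_smul]
      push_cast
      rw [zpow_zero]
      field_simp
      ring
    rw [key]
    refine norm_convex_combination_le (by have := hu₁.le; apply div_nonneg <;> linarith) ?_
      (by ring) hmid.le hone.le
    rw [sub_nonneg, div_le_one hpos]
    linarith

theorem re_exp_mul_nroot_zpow (n : ℕ) (k j : ℤ) :
    (Complex.exp ((-((2 * k + 1) * (Real.pi / n)) : ℝ) * Complex.I) * nroot n ^ j).re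
      = Real.cos ((2 * (j - k) - 1) * (Real.pi / n)) := by
  rw [nroot_zpow, ← Complex.exp_add, ← add_mul, ← Complex.ofReal_add,
    Complex.exp_ofReal_mul_I_re]
  congr 1
  ring

theorem edgeParam_ne_of_floor_lt {n : ℕ} (hn : 3 ≤ n) {x y : ℝ} (hx : 0 ≤ x) (hy : y < n)
    (hlt : ⌊x⌋ < ⌊y⌋) : edgeParam n x ≠ edgeParam n y := by
  intro h
  have hn0 : (0 : ℝ) < n := by positivity
  set a := Int.fract x
  set b := Int.fract y
  set k := ⌊x⌋
  set j := ⌊y⌋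
  set θ : ℝ := Real.pi / n with hθ
  have hθ₀ : 0 < θ := div_pos Real.pi_pos hn0
  have hnθ : n * θ = Real.pi := by rw [hθ]; field_simp
  have hk : 0 ≤ k := Int.floor_nonneg.2 hx
  have hj : j < n := Int.floor_lt.2 (by exact_mod_cast hy)
  have ha₁ : a < 1 := Int.fract_lt_one x
  have hb₀ : 0 ≤ b := Int.fract_nonneg y
  have hb₁ : b < 1 := Int.fract_lt_one y
  have hre := congrArg (fun z : ℂ =>
    (Complex.exp ((-((2 * k + 1) * θ) : ℝ) * Complex.I) * z).re) h
  simp only [edgeParam, mul_add, mul_left_comm _ ((_ : ℝ) : ℂ), Complex.add_re,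
    Complex.re_ofReal_mul, hθ, re_exp_mul_nroot_zpow] at hre
  rw [← hθ] at hre
  set m : ℝ := (j : ℝ) - k with hm
  have hm₁ : (1 : ℝ) ≤ m := by
    rw [hm]; have : (k + 1 : ℝ) ≤ j := by exact_mod_cast hlt
    linarith
  have hmn : m + 1 ≤ n := by
    have h1 : (j + 1 : ℝ) ≤ n := by exact_mod_cast hj
    have h2 : (0 : ℝ) ≤ k := by exact_mod_cast hk
    linarith
  have hs : 0 < Real.sin (m * θ) :=
    Real.sin_pos_of_pos_of_lt_pi (by positivity) (by rw [← hnθ]; nlinarith)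
  have hs₀ : 0 ≤ Real.sin ((m - 1) * θ) :=
    Real.sin_nonneg_of_nonneg_of_le_pi (mul_nonneg (by linarith) hθ₀.le)
      (by rw [← hnθ]; nlinarith)
  have hs₁ : 0 ≤ Real.sin ((m + 1) * θ) :=
    Real.sin_nonneg_of_nonneg_of_le_pi (by positivity) (by rw [← hnθ]; nlinarith)
  have hc₀ : Real.cos ((2 * m - 1) * θ)
      = Real.cos θ - 2 * Real.sin (m * θ) * Real.sin ((m - 1) * θ) := by
    have := Real.cos_sub_cos ((2 * m - 1) * θ) θ
    rw [show ((2 * m - 1) * θ + θ) / 2 = m * θ by ring,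
      show ((2 * m - 1) * θ - θ) / 2 = (m - 1) * θ by ring] at this
    linarith
  have hc₁ : Real.cos ((2 * m + 1) * θ)
      = Real.cos θ - 2 * Real.sin ((m + 1) * θ) * Real.sin (m * θ) := by
    have := Real.cos_sub_cos ((2 * m + 1) * θ) θ
    rw [show ((2 * m + 1) * θ + θ) / 2 = (m + 1) * θ by ring,
      show ((2 * m + 1) * θ - θ) / 2 = m * θ by ring] at this
    linarith
  have hneg : Real.cos ((2 * ((k : ℝ) - k) - 1) * θ) = Real.cos θ := by
    rw [← Real.cos_neg]; congr 1; ring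
  have hpos : Real.cos ((2 * (((k + 1 : ℤ) : ℝ) - k) - 1) * θ) = Real.cos θ := by
    congr 1; push_cast; ring
  have hnext : (2 * (((j + 1 : ℤ) : ℝ) - k) - 1) = 2 * m + 1 := by
    rw [hm]; push_cast; ring
  rw [hneg, hpos, hnext, hc₀, hc₁] at hre
  have hsum : Real.sin (m * θ) *
      ((1 - b) * Real.sin ((m - 1) * θ) + b * Real.sin ((m + 1) * θ)) = 0 := by linarith
  have hsum' := (mul_eq_zero.1 hsum).resolve_left hs.ne'
  have hp₀ := mul_nonneg (by linarith : 0 ≤ 1 - b) hs₀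
  have hp₁ := mul_nonneg hb₀ hs₁
  have hz₀ : Real.sin ((m - 1) * θ) = 0 :=
    (mul_eq_zero.1 (by linarith : (1 - b) * Real.sin ((m - 1) * θ) = 0)).resolve_left (by linarith)
  have hm1 : m = 1 := by
    by_contra hne
    have : 1 < m := lt_of_le_of_ne hm₁ (Ne.symm hne)
    exact (Real.sin_pos_of_pos_of_lt_pi (mul_pos (by linarith) hθ₀)
      (by rw [← hnθ]; nlinarith)).ne' hz₀
  have hn3 : (3 : ℝ) ≤ n := by exact_mod_cast hn
  have hb : b = 0 := by
    refine (mul_eq_zero.1 (by linarith : b * Real.sin ((m + 1) * θ) = 0)).resolve_right ?_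
    exact (Real.sin_pos_of_pos_of_lt_pi (by positivity) (by rw [← hnθ, hm1]; nlinarith)).ne'
  have hjk : j = k + 1 := by
    have : (j : ℝ) = k + 1 := by linarith
    exact_mod_cast this
  have hvert : edgeParam n y = nroot n ^ (k + 1) := by
    change ((1 - b : ℝ) : ℂ) * nroot n ^ j + (b : ℂ) * nroot n ^ (j + 1) = _
    rw [hb, hjk]; simp
  have hfac : ((1 - a : ℝ) : ℂ) * (nroot n ^ k * (nroot n - 1)) = 0 := by
    have hxv : ((1 - a : ℝ) : ℂ) * nroot n ^ k + (a : ℂ) * nroot n ^ (k + 1)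
        = nroot n ^ (k + 1) := h.trans hvert
    rw [zpow_add_one₀ (nroot_ne_zero n)] at hxv
    push_cast at hxv ⊢
    linear_combination -hxv
  have hne : ((1 - a : ℝ) : ℂ) ≠ 0 := by
    exact_mod_cast (sub_pos.2 ha₁).ne'
  exact mul_ne_zero hne (mul_ne_zero (zpow_ne_zero _ (nroot_ne_zero n))
    (sub_ne_zero.2 (nroot_ne_one (by lia)))) hfac

theorem edgeParam_injOn {n : ℕ} (hn : 3 ≤ n) : Set.InjOn (edgeParam n) (Set.Ico 0 (n : ℝ)) := by
  rintro x ⟨hx₀, hx₁⟩ y ⟨hy₀, hy₁⟩ h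
  rcases lt_trichotomy ⌊x⌋ ⌊y⌋ with hlt | heq | hlt
  · exact absurd h (edgeParam_ne_of_floor_lt hn hx₀ hy₁ hlt)
  · have hfac : ((Int.fract x - Int.fract y : ℝ) : ℂ) * (nroot n ^ ⌊y⌋ * (nroot n - 1)) = 0 := by
      rw [edgeParam, edgeParam, heq, zpow_add_one₀ (nroot_ne_zero n)] at h
      push_cast at h ⊢
      linear_combination h
    have hz := (mul_eq_zero.1 hfac).resolve_right
      (mul_ne_zero (zpow_ne_zero _ (nroot_ne_zero n)) (sub_ne_zero.2 (nroot_ne_one (by lia))))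
    rw [Complex.ofReal_eq_zero, sub_eq_zero] at hz
    rw [← Int.floor_add_fract x, ← Int.floor_add_fract y, heq, hz]
  · exact absurd h.symm (edgeParam_ne_of_floor_lt hn hy₀ hx₁ hlt)

theorem polyParam_injOn {n : ℕ} (hn : 3 ≤ n) : Set.InjOn (polyParam n) (Set.Ico 0 1) := by
  have hn0 : (0 : ℝ) < n := by positivity
  have hmem : ∀ t ∈ Set.Ico (0 : ℝ) 1, (n : ℝ) * t ∈ Set.Ico 0 (n : ℝ) := fun t ht =>
    ⟨mul_nonneg hn0.le ht.1, by nlinarith [ht.2]⟩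
  intro s hs t ht h
  exact mul_left_cancel₀ hn0.ne' (edgeParam_injOn hn (hmem s hs) (hmem t ht) h)

theorem polyParam_fract {n : ℕ} (hn : n ≠ 0) (t : ℝ) :
    polyParam n (Int.fract t) = polyParam n t := by
  rw [polyParam_eq_edgeParam, polyParam_eq_edgeParam,
    ← edgeParam_add_nat_mul hn (n * Int.fract t) ⌊t⌋, ← mul_add, Int.fract_add_floor]

theorem polyArg_polyParam {n : ℕ} (hn : 3 ≤ n) (t : ℝ) :
    polyArg n (polyParam n t) = Int.fract t := by
  have hset : {s : ℝ | s ∈ Set.Ico (0 : ℝ) 1 ∧ polyParam n s = polyParam n t}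
      = {Int.fract t} := by
    have ht : Int.fract t ∈ Set.Ico (0 : ℝ) 1 := ⟨Int.fract_nonneg t, Int.fract_lt_one t⟩
    ext s
    constructor
    · rintro ⟨hs, h⟩
      exact polyParam_injOn hn hs ht (h.trans (polyParam_fract (by lia) t).symm)
    · rintro rfl
      exact ⟨ht, polyParam_fract (by lia) t⟩
  rw [polyArg, hset, csInf_singleton]

theorem polyDist_polyParam {n : ℕ} (hn : 3 ≤ n) (s t : ℝ) :
    polyDist n (polyParam n s) (polyParam n t) = Int.fract (t - s) := by
  rw [polyDist, polyArg_polyParam hn, polyArg_polyParam hn, Int.fract_eq_fract]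
  exact ⟨⌊s⌋ - ⌊t⌋, by rw [Int.fract, Int.fract]; push_cast; ring⟩

theorem exists_polyParam_eq_of_mem {n : ℕ} (hn : n ≠ 0) {x : ℂ} (hx : x ∈ polygon n) :
    ∃ t, polyParam n t = x := by
  simp only [polygon, Set.mem_iUnion, exists_prop] at hx
  obtain ⟨j, -, a, b, ha, hb, hab, rfl⟩ := hx
  have hn0 : (n : ℝ) ≠ 0 := by exact_mod_cast hn
  refine ⟨(j + b) / n, ?_⟩
  rw [polyParam_eq_edgeParam, mul_div_cancel₀ _ hn0,
    edgeParam_eq_of_mem n j (by push_cast; linarith) (by push_cast; linarith)]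
  have ha' : ((j : ℤ) + 1 - (j + b) : ℝ) = a := by push_cast; linarith
  have hb' : ((j + b) - (j : ℤ) : ℝ) = b := by push_cast; ring
  rw [ha', hb', Complex.real_smul, Complex.real_smul]
  norm_cast

theorem polyParam_mem_polygon {n : ℕ} (hn : n ≠ 0) (t : ℝ) : polyParam n t ∈ polygon n := by
  rw [← polyParam_fract hn]
  set s := Int.fract t
  have hs₀ : 0 ≤ s := Int.fract_nonneg t
  have hs₁ : s < 1 := Int.fract_lt_one t
  have hn0 : (0 : ℝ) < n := by positivity
  have hfl : 0 ≤ ⌊n * s⌋ := Int.floor_nonneg.2 (by positivity)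
  obtain ⟨j, hj⟩ := Int.eq_ofNat_of_zero_le hfl
  have hjn : j < n := by
    have : ⌊n * s⌋ < (n : ℤ) := Int.floor_lt.2 (by push_cast; nlinarith)
    lia
  simp only [polygon, Set.mem_iUnion, exists_prop]
  refine ⟨j, Finset.mem_range.2 hjn, 1 - Int.fract (n * s), Int.fract (n * s),
    sub_nonneg.2 (Int.fract_lt_one _).le, Int.fract_nonneg _, by ring, ?_⟩
  rw [polyParam, hj, Complex.real_smul, Complex.real_smul]
  norm_cast

/-- Lemma: the dynamical system is slowest at vertices. Let `n ≥ 4`, `0 < r < r_n`, `v` a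
vertex of `P_n` and `p ∈ P_n` arbitrary. If `v'` (resp. `p'`) is the point of `P_n` at
Euclidean distance exactly `r` counterclockwise from `v` (resp. `p`), in the sense that every
point of `P_n` strictly counterclockwise-between is at distance `< r`, then
`d_{P_n}(v, v') ≤ d_{P_n}(p, p')`. -/
theorem vertex_min_winding (n : ℕ) (hn : 4 ≤ n) (r : ℝ) (hr0 : 0 < r) (hr : r < rpoly n)
    (v : ℂ) (hv : IsVertex n v) (p : ℂ) (hp : p ∈ polygon n)
    (v' : ℂ) (hv' : v' ∈ polygon n) (hvv' : dist v v' = r)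
    (hvmax : ∀ z ∈ polygon n, SCCWBtw n v z v' → dist v z < r)
    (p' : ℂ) (hp' : p' ∈ polygon n) (hpp' : dist p p' = r)
    (hpmax : ∀ z ∈ polygon n, SCCWBtw n p z p' → dist p z < r) :
    polyDist n v v' ≤ polyDist n p p' := by
  have hn3 : 3 ≤ n := by lia
  have hn0 : n ≠ 0 := by lia
  by_contra! hlt
  obtain ⟨s, rfl⟩ := exists_polyParam_eq_of_mem hn0 hp
  obtain ⟨s', rfl⟩ := exists_polyParam_eq_of_mem hn0 hp'
  obtain ⟨j, -, hj⟩ := hv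
  have hnR : (n : ℝ) ≠ 0 := by exact_mod_cast hn0
  have hmul (w : ℝ) : (n : ℝ) * (j / n + w) = n * w + (j : ℤ) := by
    field_simp
    push_cast
    ring
  have hvj : v = polyParam n (j / n) := by
    rw [polyParam_eq_edgeParam, mul_div_cancel₀ _ hnR, hj, ← zpow_natCast, ← edgeParam_intCast]
    norm_cast
  rw [polyDist_polyParam hn3] at hlt
  set d := Int.fract (s' - s) with hd
  have hs' : polyParam n s' = edgeParam n (n * s + n * d) := by
    rw [polyParam_eq_edgeParam, ← edgeParam_add_nat_mul hn0 (n * s + n * d) ⌊s' - s⌋]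
    congr 1
    rw [hd, ← mul_add, ← mul_add, add_assoc, Int.fract_add_floor]
    ring
  have hd0 : 0 < d := by
    refine (Int.fract_nonneg _).lt_of_ne fun h0 => hr0.ne' ?_
    rw [← hpp', hs', hd, ← h0, polyParam_eq_edgeParam, mul_zero, add_zero, dist_self]
  have hvz : polyDist n v (polyParam n (j / n + d)) = d := by
    rw [hvj, polyDist_polyParam hn3, add_sub_cancel_left, hd, Int.fract_fract]
  have hz := hvmax _ (polyParam_mem_polygon hn0 (j / n + d))
    ⟨by rwa [hvz], by rwa [hvz]⟩
  have hchord := norm_edgeParam_add_sub_le n (n * s) (n * d)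
  rw [← hs', ← polyParam_eq_edgeParam, ← dist_eq_norm, dist_comm, hpp'] at hchord
  refine (hz.trans_le hchord).ne ?_
  have hv0 : v = nroot n ^ (j : ℤ) * edgeParam n 0 := by
    rw [← edgeParam_add_int, zero_add, edgeParam_intCast, zpow_natCast, hj]
  rw [polyParam_eq_edgeParam, hmul, edgeParam_add_int, hv0, dist_comm, dist_eq_norm, ← mul_sub,
    norm_mul, norm_nroot_zpow, one_mul]
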